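/- Let H₊ and H₋ be complex Hilbert spaces and let A, B : H₊ → H₋ be bounded linear operators, with graphs 𝒜 = {(h, Ah)} and ℬ = {(x, Bx)} in H = H₊ × H₋ (product inner product). Then the composite map 𝒜 → ℬ → 𝒜 given by orthogonal projection of 𝒜 onto ℬ followed by orthogonal projection of ℬ onto 𝒜 sends (h, Ah) to (z, Az) with z = DV_{AB} h, where DV_{AB} = (Id + A*A)⁻¹(Id + A*B)(Id + B*B)⁻¹(Id + B*A) is the operator angle between the subspaces 𝒜 and ℬ. -/

import Mathlib

open ContinuousLinearMap

/-- The operator angle `DV_{AB} = (Id + A*A)⁻¹ (Id + A*B) (Id + B*B)⁻¹ (Id + B*A)`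
between the graphs of two bounded operators `A B : H₊ →L H₋`. -/
noncomputable def operatorAngle {Hp Hm : Type*}
    [NormedAddCommGroup Hp] [InnerProductSpace ℂ Hp] [CompleteSpace Hp]
    [NormedAddCommGroup Hm] [InnerProductSpace ℂ Hm] [CompleteSpace Hm]
    (A B : Hp →L[ℂ] Hm) : Hp →L[ℂ] Hp :=
  (Ring.inverse ((1 : Hp →L[ℂ] Hp) + (adjoint A).comp A)).comp
    (((1 : Hp →L[ℂ] Hp) + (adjoint A).comp B).comp
      ((Ring.inverse ((1 : Hp →L[ℂ] Hp) + (adjoint B).comp B)).comp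
        ((1 : Hp →L[ℂ] Hp) + (adjoint B).comp A)))

theorem isUnit_one_add_adj {Hp Hm : Type*}
    [NormedAddCommGroup Hp] [InnerProductSpace ℂ Hp] [CompleteSpace Hp]
    [NormedAddCommGroup Hm] [InnerProductSpace ℂ Hm] [CompleteSpace Hm]
    (A : Hp →L[ℂ] Hm) : IsUnit ((1 : Hp →L[ℂ] Hp) + (adjoint A).comp A) := by
  refine ContinuousLinearMap.isUnit_of_forall_le_norm_inner_map _ (c := 1) one_pos ?_
  intro x
  have h1 : inner ℂ (((1 : Hp →L[ℂ] Hp) + (adjoint A).comp A) x) x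
      = ((‖x‖ ^ 2 + ‖A x‖ ^ 2 : ℝ) : ℂ) := by
    simp [inner_add_left, adjoint_inner_left, inner_self_eq_norm_sq_to_K]
  rw [h1, Complex.norm_real, Real.norm_of_nonneg (by positivity)]
  simp only [NNReal.coe_one, mul_one]
  nlinarith [sq_nonneg ‖A x‖]

theorem eq_inverse_apply {Hp Hm : Type*}
    [NormedAddCommGroup Hp] [InnerProductSpace ℂ Hp] [CompleteSpace Hp]
    [NormedAddCommGroup Hm] [InnerProductSpace ℂ Hm] [CompleteSpace Hm]
    (A B : Hp →L[ℂ] Hm) (h x : Hp)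
    (hx : ∀ u : Hp, (inner ℂ (h - x) u : ℂ) + (inner ℂ (A h - B x) (B u) : ℂ) = 0) :
    x = Ring.inverse ((1 : Hp →L[ℂ] Hp) + (adjoint B).comp B)
      (((1 : Hp →L[ℂ] Hp) + (adjoint B).comp A) h) := by
  have h1 : (h - x) + adjoint B (A h - B x) = 0 := by
    refine ext_inner_right ℂ fun u => ?_
    rw [inner_add_left, adjoint_inner_left, hx u, inner_zero_left]
  have h2 : ((1 : Hp →L[ℂ] Hp) + (adjoint B).comp A) h
      = ((1 : Hp →L[ℂ] Hp) + (adjoint B).comp B) x := by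
    rw [← sub_eq_zero, ← h1]
    simp only [add_apply, one_apply_eq_self, comp_apply, map_sub]
    abel
  rw [h2]
  have h3 := congrArg (fun T : Hp →L[ℂ] Hp => T x)
    (Ring.inverse_mul_cancel _ (isUnit_one_add_adj B))
  exact h3.symm

/-- Let `A B : H₊ →L H₋` be bounded operators between complex Hilbert
spaces with graphs `𝒜 = {(h, Ah)}`, `ℬ = {(x, Bx)}` in `H = H₊ × H₋` (product inner
product).  If `(x, Bx)` is the orthogonal projection of `(h, Ah)` onto `ℬ` (i.e. the
difference is orthogonal to every `(u, Bu)`), and `(z, Az)` is the orthogonal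
projection of `(x, Bx)` onto `𝒜` (i.e. the difference is orthogonal to every
`(u, Au)`), then `z = DV_{AB} h`: the composite of the two orthogonal projections
sends `(h, Ah)` to `(z, Az)` with `z = (Id+A*A)⁻¹(Id+A*B)(Id+B*B)⁻¹(Id+B*A) h`. -/
theorem operatorAngle_eq_comp_orthogonal_projections
    {Hp Hm : Type*}
    [NormedAddCommGroup Hp] [InnerProductSpace ℂ Hp] [CompleteSpace Hp]
    [NormedAddCommGroup Hm] [InnerProductSpace ℂ Hm] [CompleteSpace Hm]
    (A B : Hp →L[ℂ] Hm) (h x z : Hp)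
    (hx : ∀ u : Hp, (inner ℂ (h - x) u : ℂ) + (inner ℂ (A h - B x) (B u) : ℂ) = 0)
    (hz : ∀ u : Hp, (inner ℂ (x - z) u : ℂ) + (inner ℂ (B x - A z) (A u) : ℂ) = 0) :
    z = operatorAngle A B h := by
  have e1 := eq_inverse_apply A B h x hx
  have e2 := eq_inverse_apply B A x z hz
  rw [e2, e1]
  rfl
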